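/- arXiv:1709.08305 — 2 statements merged into one kernel-verified Lean document; each statement's English description precedes it below -/
import Mathlib

section
/- Let g be a smooth even integrable probability density with g' and g'' integrable. Then lim_{z→0+, z real} ∫_ℝ g(ω)/(z - iω)^3 dω = -(π/2) g''(0). -/
open MeasureTheory Filter Topology Set

lemma ofReal_sub_I_mul_ne_zero {z : ℝ} (hz : 0 < z) (ω : ℝ) :
    (z : ℂ) - Complex.I * (ω : ℂ) ≠ 0 := by
  intro h
  have := congrArg Complex.re h
  simp at this
  exact hz.ne' this

lemma integrable_ofReal_mul_inv_pow {u : ℝ → ℝ} (hu : Integrable u) {z : ℝ} (hz : 0 < z) (n : ℕ) :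
    Integrable fun ω : ℝ => (u ω : ℂ) * (((z : ℂ) - Complex.I * (ω : ℂ)) ^ n)⁻¹ := by
  have hcont : Continuous fun ω : ℝ => (((z : ℂ) - Complex.I * (ω : ℂ)) ^ n)⁻¹ :=
    Continuous.inv₀ (by fun_prop) fun ω => pow_ne_zero _ (ofReal_sub_I_mul_ne_zero hz ω)
  refine Integrable.mul_bdd (c := (z ^ n)⁻¹) hu.ofReal hcont.aestronglyMeasurable
    (ae_of_all _ fun ω => ?_)
  rw [norm_inv, norm_pow]
  have hre : z ≤ ‖(z : ℂ) - Complex.I * (ω : ℂ)‖ := by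
    simpa using Complex.re_le_norm ((z : ℂ) - Complex.I * (ω : ℂ))
  gcongr

lemma hasDerivAt_inv_pow_ofReal_sub_I_mul {z : ℝ} (hz : 0 < z) (n : ℕ) (ω : ℝ) :
    HasDerivAt (fun ω : ℝ => (((z : ℂ) - Complex.I * (ω : ℂ)) ^ n)⁻¹)
      (n * Complex.I * (((z : ℂ) - Complex.I * (ω : ℂ)) ^ (n + 1))⁻¹) ω := by
  have hne := ofReal_sub_I_mul_ne_zero hz ω
  have hlin : HasDerivAt (fun ω : ℝ => (z : ℂ) - Complex.I * (ω : ℂ)) (-Complex.I) ω := by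
    simpa using (((hasDerivAt_id ω).ofReal_comp).const_mul Complex.I).const_sub (z : ℂ)
  refine ((hlin.fun_pow n).fun_inv (pow_ne_zero n hne)).congr_deriv ?_
  rcases n with _ | n
  · simp
  · rw [Nat.add_sub_cancel]
    field_simp
    ring

/-- Integration by parts against a power of `1 / (z - iω)`. -/
lemma integral_ofReal_mul_inv_pow_succ {u : ℝ → ℝ} (hd : Differentiable ℝ u) (hu : Integrable u)
    (hu' : Integrable (deriv u)) {z : ℝ} (hz : 0 < z) (n : ℕ) :
    n * Complex.I * ∫ ω : ℝ, (u ω : ℂ) * (((z : ℂ) - Complex.I * (ω : ℂ)) ^ (n + 1))⁻¹ =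
      -∫ ω : ℝ, ((deriv u ω : ℝ) : ℂ) * (((z : ℂ) - Complex.I * (ω : ℂ)) ^ n)⁻¹ := by
  rw [← integral_const_mul]
  have hcomm : (fun ω : ℝ => n * Complex.I *
      ((u ω : ℂ) * (((z : ℂ) - Complex.I * (ω : ℂ)) ^ (n + 1))⁻¹)) =
      fun ω : ℝ => (u ω : ℂ) *
        (n * Complex.I * (((z : ℂ) - Complex.I * (ω : ℂ)) ^ (n + 1))⁻¹) := by
    funext ω
    ring
  have hint := (integrable_ofReal_mul_inv_pow hu hz (n + 1)).const_mul (n * Complex.I)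
  rw [hcomm] at hint ⊢
  exact integral_mul_deriv_eq_deriv_mul_of_integrable
    (fun ω _ => (hd ω).hasDerivAt.ofReal_comp)
    (fun ω _ => hasDerivAt_inv_pow_ofReal_sub_I_mul hz n ω)
    hint (integrable_ofReal_mul_inv_pow hu' hz n) (integrable_ofReal_mul_inv_pow hu hz n)

/-- Against an even function, the kernel `1 / (z - iω)` reduces to its even part. -/
lemma integral_ofReal_mul_inv_of_even {u : ℝ → ℝ} (hu : Integrable u) (heven : ∀ x, u (-x) = u x)
    {z : ℝ} (hz : 0 < z) :
    ∫ ω : ℝ, (u ω : ℂ) * ((z : ℂ) - Complex.I * (ω : ℂ))⁻¹ =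
      ((∫ ω : ℝ, z / (z ^ 2 + ω ^ 2) * u ω : ℝ) : ℂ) := by
  set F : ℝ → ℂ := fun ω => (u ω : ℂ) * ((z : ℂ) - Complex.I * (ω : ℂ))⁻¹ with hF
  have hint : Integrable F := by simpa using integrable_ofReal_mul_inv_pow hu hz 1
  have hsum : ∀ ω, F ω + F (-ω) = 2 * ((z / (z ^ 2 + ω ^ 2) * u ω : ℝ) : ℂ) := by
    intro ω
    have h1 := ofReal_sub_I_mul_ne_zero hz ω
    have h2 := ofReal_sub_I_mul_ne_zero hz (-ω)
    have hprod : (z : ℂ) ^ 2 + (ω : ℂ) ^ 2 =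
        ((z : ℂ) - Complex.I * ω) * ((z : ℂ) - Complex.I * (-ω : ℝ)) := by
      push_cast
      linear_combination (ω : ℂ) ^ 2 * Complex.I_sq
    simp only [hF, heven]
    rw [Complex.ofReal_mul, Complex.ofReal_div, Complex.ofReal_add, Complex.ofReal_pow,
      Complex.ofReal_pow, hprod]
    field_simp
    push_cast
    ring
  have hadd := integral_add hint hint.comp_neg
  rw [integral_neg_eq_self] at hadd
  simp only [hsum] at hadd
  rw [integral_const_mul, integral_complex_ofReal] at hadd
  linear_combination (-1 / 2 : ℂ) * hadd

/-- The Poisson kernel of the half-plane is an approximate identity. -/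
lemma tendsto_integral_poisson_mul {u : ℝ → ℝ} (hu : Integrable u) (hc : ContinuousAt u 0) :
    Tendsto (fun z : ℝ => ∫ ω : ℝ, z / (z ^ 2 + ω ^ 2) * u ω) (𝓝[>] 0)
      (𝓝 (Real.pi * u 0)) := by
  have hdecay : Tendsto (fun x : ℝ => ‖x‖ ^ Module.finrank ℝ ℝ * (Real.pi⁻¹ * (1 + x ^ 2)⁻¹))
      (Bornology.cobounded ℝ) (𝓝 0) := by
    have hinv : Tendsto (fun x : ℝ => Real.pi⁻¹ * ‖x‖⁻¹) (Bornology.cobounded ℝ) (𝓝 0) := by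
      simpa using (tendsto_inv_atTop_zero.comp
        (tendsto_norm_cobounded_atTop (E := ℝ))).const_mul Real.pi⁻¹
    refine squeeze_zero' (Eventually.of_forall fun x => by positivity) ?_ hinv
    filter_upwards [Bornology.eventually_ne_cobounded (0 : ℝ)] with x hx
    have hx' : 0 < ‖x‖ := norm_pos_iff.mpr hx
    have hle : ‖x‖ * (1 + x ^ 2)⁻¹ ≤ ‖x‖⁻¹ := by
      rw [← sq_abs x, ← Real.norm_eq_abs, ← div_eq_mul_inv, div_le_iff₀ (by positivity)]
      field_simp
      linarith
    rw [Module.finrank_self, pow_one]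
    calc ‖x‖ * (Real.pi⁻¹ * (1 + x ^ 2)⁻¹) = Real.pi⁻¹ * (‖x‖ * (1 + x ^ 2)⁻¹) := by ring
      _ ≤ Real.pi⁻¹ * ‖x‖⁻¹ := by gcongr
  have hpeak := (tendsto_integral_comp_smul_smul_of_integrable (μ := volume)
    (φ := fun x : ℝ => Real.pi⁻¹ * (1 + x ^ 2)⁻¹) (fun x => by positivity)
    (by rw [integral_const_mul, integral_univ_inv_one_add_sq,
      inv_mul_cancel₀ Real.pi_ne_zero]) hdecay hu hc).const_mul Real.pi
  refine (hpeak.comp tendsto_inv_nhdsGT_zero).congr' ?_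
  filter_upwards [self_mem_nhdsWithin] with z (hz : 0 < z)
  simp only [Function.comp_apply]
  rw [← integral_const_mul]
  congr 1 with ω
  have hpos : 0 < z ^ 2 + ω ^ 2 := by positivity
  have hpi := Real.pi_ne_zero
  simp only [Module.finrank_self, pow_one, smul_eq_mul]
  field_simp

lemma deriv_deriv_neg_of_even {u : ℝ → ℝ} (heven : ∀ x, u (-x) = u x) (x : ℝ) :
    deriv (deriv u) (-x) = deriv (deriv u) x := by
  have hodd : deriv u = fun y => -deriv u (-y) := by
    funext y
    rw [← deriv_comp_neg]
    simp only [heven]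
  conv_rhs => rw [hodd]
  simp [deriv_comp_neg]

/-- For a smooth even integrable probability density `g` with `g'`, `g''` integrable,
`lim_{z→0+} ∫ g(ω)/(z-iω)^3 dω = -(π/2) g''(0)`. -/
theorem stmt4 (g : ℝ → ℝ) (hg : ContDiff ℝ 2 g) (heven : ∀ x, g (-x) = g x)
    (hnn : ∀ x, 0 ≤ g x) (hg_int : Integrable g) (hprob : ∫ ω, g ω = 1)
    (hg'_int : Integrable (deriv g)) (hg''_int : Integrable (deriv (deriv g))) :
    Tendsto (fun z : ℝ => ∫ ω : ℝ, (g ω : ℂ) / ((z : ℂ) - Complex.I * (ω : ℂ)) ^ 3)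
      (𝓝[>] 0) (𝓝 ((-(Real.pi / 2) * deriv (deriv g) 0 : ℝ) : ℂ)) := by
  have hg' : ContDiff ℝ 1 (deriv g) := hg.deriv'
  have hg'' : Continuous (deriv (deriv g)) := hg'.continuous_deriv le_rfl
  have hlim := (tendsto_integral_poisson_mul hg''_int hg''.continuousAt).const_mul (-(1 / 2))
  rw [show -(1 / 2) * (Real.pi * deriv (deriv g) 0) = -(Real.pi / 2) * deriv (deriv g) 0 by ring]
    at hlim
  refine ((Complex.continuous_ofReal.tendsto _).comp hlim).congr' ?_
  filter_upwards [self_mem_nhdsWithin] with z (hz : 0 < z)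
  have h1 := integral_ofReal_mul_inv_pow_succ (hg.differentiable two_ne_zero) hg_int hg'_int hz 2
  have h2 := integral_ofReal_mul_inv_pow_succ (hg'.differentiable one_ne_zero) hg'_int hg''_int hz 1
  have h3 := integral_ofReal_mul_inv_of_even hg''_int (deriv_deriv_neg_of_even heven) hz
  simp only [pow_one, Nat.reduceAdd, Nat.cast_ofNat, Nat.cast_one, one_mul] at h1 h2
  simp only [Function.comp_apply, div_eq_mul_inv (_ : ℂ)]
  rw [Complex.ofReal_mul, ← h3]
  push_cast
  linear_combination (1 / 2 * Complex.I) * h1 - (1 / 2) * h2 -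
    (∫ ω : ℝ, (g ω : ℂ) * (((z : ℂ) - Complex.I * (ω : ℂ)) ^ 3)⁻¹) * Complex.I_sq
end

section
/- Let g be a smooth even integrable probability density with g' integrable, unimodal (g'(x) ≤ 0 for x > 0, not identically zero). Define D(z) = ∫_ℝ g(ω)/(z - iω) dω for Re(z) > 0. Then lim_{z→0+, z real} D'(z) = -π H[g'](0), which is a strictly negative real number. -/
open MeasureTheory Filter Topology Set

lemma re_le_norm_sub_I_mul (z : ℂ) (ω : ℝ) : z.re ≤ ‖z - Complex.I * (ω : ℂ)‖ := by
  have h := (le_abs_self _).trans (Complex.abs_re_le_norm (z - Complex.I * (ω : ℂ)))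
  simpa using h

lemma sub_I_mul_ne_zero {z : ℂ} (hz : 0 < z.re) (ω : ℝ) : z - Complex.I * (ω : ℂ) ≠ 0 :=
  norm_pos_iff.mp (hz.trans_le (re_le_norm_sub_I_mul z ω))

lemma continuous_inv_sub_I_mul {z : ℂ} (hz : 0 < z.re) :
    Continuous fun ω : ℝ => (z - Complex.I * (ω : ℂ))⁻¹ :=
  Continuous.inv₀ (by fun_prop) (sub_I_mul_ne_zero hz)

lemma norm_inv_sub_I_mul_le {z : ℂ} {c : ℝ} (hc : 0 < c) (hz : c ≤ z.re) (ω : ℝ) :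
    ‖(z - Complex.I * (ω : ℂ))⁻¹‖ ≤ c⁻¹ := by
  rw [norm_inv]
  exact inv_anti₀ hc (hz.trans (re_le_norm_sub_I_mul z ω))

lemma integrable_mul_inv_sub_I_mul_pow {f : ℝ → ℝ} (hf : Integrable f) {z : ℂ} (hz : 0 < z.re)
    (n : ℕ) : Integrable fun ω : ℝ => (f ω : ℂ) * (z - Complex.I * (ω : ℂ))⁻¹ ^ n := by
  refine hf.ofReal.mul_bdd (c := z.re⁻¹ ^ n)
    ((continuous_inv_sub_I_mul hz).pow n).aestronglyMeasurable (ae_of_all _ fun ω => ?_)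
  rw [norm_pow]
  exact pow_le_pow_left₀ (norm_nonneg _) (norm_inv_sub_I_mul_le hz le_rfl ω) n

lemma hasDerivAt_integral_div_sub_I_mul {g : ℝ → ℝ} (hg : Integrable g) {z : ℂ} (hz : 0 < z.re) :
    HasDerivAt (fun z : ℂ => ∫ ω : ℝ, (g ω : ℂ) / (z - Complex.I * (ω : ℂ)))
      (∫ ω : ℝ, (g ω : ℂ) * -(z - Complex.I * (ω : ℂ))⁻¹ ^ 2) z := by
  have hU : IsOpen {w : ℂ | z.re / 2 < w.re} := isOpen_lt continuous_const Complex.continuous_re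
  have hint : ∀ w : ℂ, 0 < w.re →
      Integrable fun ω : ℝ => (g ω : ℂ) / (w - Complex.I * (ω : ℂ)) := fun w hw => by
    simpa [div_eq_mul_inv] using integrable_mul_inv_sub_I_mul_pow hg hw 1
  refine (hasDerivAt_integral_of_dominated_loc_of_deriv_le
    (F' := fun z ω => (g ω : ℂ) * -(z - Complex.I * (ω : ℂ))⁻¹ ^ 2)
    (bound := fun ω => ‖g ω‖ * (z.re / 2)⁻¹ ^ 2)
    (hU.mem_nhds (half_lt_self hz)) ?_ (hint z hz) ?_ ?_ (hg.norm.mul_const _) ?_).2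
  · filter_upwards [hU.mem_nhds (half_lt_self hz)] with w hw
    exact (hint w ((half_pos hz).trans hw)).aestronglyMeasurable
  · simpa only [Pi.neg_def, mul_neg] using
      (integrable_mul_inv_sub_I_mul_pow hg hz 2).neg.aestronglyMeasurable
  · refine ae_of_all _ fun ω w hw => ?_
    rw [norm_mul, norm_neg, norm_pow, Complex.norm_real]
    gcongr
    exact norm_inv_sub_I_mul_le (half_pos hz) (le_of_lt hw) ω
  · refine ae_of_all _ fun ω w hw => ?_
    have hne := sub_I_mul_ne_zero ((half_pos hz).trans hw) ω
    have h := (((hasDerivAt_id w).sub_const (Complex.I * (ω : ℂ))).inv hne).const_mul (g ω : ℂ)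
    simpa [div_eq_mul_inv] using h

lemma integral_mul_neg_inv_sq_eq {g : ℝ → ℝ} (hg : Differentiable ℝ g) (hg_int : Integrable g)
    (hg'_int : Integrable (deriv g)) {z : ℂ} (hz : 0 < z.re) :
    ∫ ω : ℝ, (g ω : ℂ) * -(z - Complex.I * (ω : ℂ))⁻¹ ^ 2 =
      -Complex.I * ∫ ω : ℝ, ((deriv g ω : ℝ) : ℂ) * (z - Complex.I * (ω : ℂ))⁻¹ := by
  have hv : ∀ ω : ℝ, HasDerivAt (fun ω : ℝ => (z - Complex.I * (ω : ℂ))⁻¹)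
      (Complex.I * (z - Complex.I * (ω : ℂ))⁻¹ ^ 2) ω := fun ω => by
    have h := (((Complex.ofRealCLM.hasDerivAt (x := ω)).const_mul Complex.I).const_sub z).inv
      (sub_I_mul_ne_zero hz ω)
    exact h.congr_deriv (by simp [div_eq_mul_inv])
  have hint2 := integrable_mul_inv_sub_I_mul_pow hg_int hz 2
  have h := integral_mul_deriv_eq_deriv_mul_of_integrable
    (fun ω _ => (hg ω).hasDerivAt.ofReal_comp) (fun ω _ => hv ω)
    ((hint2.const_mul Complex.I).congr (ae_of_all _ fun ω => by simp; ring))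
    ((integrable_mul_inv_sub_I_mul_pow hg'_int hz 1).congr (ae_of_all _ fun ω => by simp))
    ((integrable_mul_inv_sub_I_mul_pow hg_int hz 1).congr (ae_of_all _ fun ω => by simp))
  have h' : ∫ ω : ℝ, (g ω : ℂ) * (Complex.I * (z - Complex.I * (ω : ℂ))⁻¹ ^ 2) =
      -Complex.I * ∫ ω : ℝ, (g ω : ℂ) * -(z - Complex.I * (ω : ℂ))⁻¹ ^ 2 := by
    rw [← integral_const_mul]
    congr 1 with ω
    ring
  rw [h'] at h
  linear_combination Complex.I * h +
    (∫ ω : ℝ, (g ω : ℂ) * -(z - Complex.I * (ω : ℂ))⁻¹ ^ 2) * Complex.I_sq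

lemma integral_odd_mul_inv_sub_I_mul {f : ℝ → ℝ} (hodd : ∀ x, f (-x) = -f x) (hf : Integrable f)
    {x : ℝ} (hx : 0 < x) :
    -Complex.I * ∫ ω : ℝ, (f ω : ℂ) * ((x : ℂ) - Complex.I * (ω : ℂ))⁻¹ =
      ((∫ ω : ℝ, f ω * (ω / (x ^ 2 + ω ^ 2)) : ℝ) : ℂ) := by
  have hz : 0 < (x : ℂ).re := by simpa using hx
  have hint : Integrable fun ω : ℝ => (f ω : ℂ) * ((x : ℂ) - Complex.I * (ω : ℂ))⁻¹ := by
    simpa using integrable_mul_inv_sub_I_mul_pow hf hz 1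
  have hsum : ∀ ω : ℝ, (f ω : ℂ) * ((x : ℂ) - Complex.I * (ω : ℂ))⁻¹ +
      (f (-ω) : ℂ) * ((x : ℂ) - Complex.I * ((-ω : ℝ) : ℂ))⁻¹ =
      2 * Complex.I * ((f ω * (ω / (x ^ 2 + ω ^ 2)) : ℝ) : ℂ) := fun ω => by
    have h1 := sub_I_mul_ne_zero hz ω
    have h2 : (x : ℂ) + Complex.I * ω ≠ 0 := by simpa using sub_I_mul_ne_zero hz (-ω)
    have h3 : ((x : ℂ) ^ 2 + (ω : ℂ) ^ 2) =
        (x - Complex.I * (ω : ℂ)) * (x + Complex.I * (ω : ℂ)) := by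
      linear_combination ((ω : ℂ) ^ 2) * Complex.I_sq
    rw [hodd]
    push_cast
    rw [h3, mul_neg, sub_neg_eq_add]
    field_simp
    ring
  have hneg : ∫ ω : ℝ, (f (-ω) : ℂ) * ((x : ℂ) - Complex.I * ((-ω : ℝ) : ℂ))⁻¹ =
      ∫ ω : ℝ, (f ω : ℂ) * ((x : ℂ) - Complex.I * (ω : ℂ))⁻¹ :=
    integral_neg_eq_self (fun ω : ℝ => (f ω : ℂ) * ((x : ℂ) - Complex.I * (ω : ℂ))⁻¹) volume
  have h := integral_add hint hint.comp_neg
  simp only [hsum] at h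
  rw [hneg, integral_const_mul, integral_complex_ofReal] at h
  linear_combination (Complex.I / 2) * h -
    ((∫ ω : ℝ, f ω * (ω / (x ^ 2 + ω ^ 2)) : ℝ) : ℂ) * Complex.I_sq

lemma integrable_div_of_tendsto {f : ℝ → ℝ} (hf : Integrable f) (hnn : ∀ s, 0 ≤ f s / (0 - s))
    {L : ℝ} (hL : Tendsto (fun ε : ℝ => ∫ s in {s : ℝ | ε ≤ |s|}, f s / (0 - s))
      (𝓝[>] 0) (𝓝 L)) :
    Integrable (fun s => f s / (0 - s)) ∧ ∫ s, f s / (0 - s) = L := by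
  have hu : Tendsto (fun n : ℕ => (1 : ℝ) / (n + 1)) atTop (𝓝[>] 0) :=
    tendsto_nhdsWithin_iff.mpr ⟨tendsto_one_div_add_atTop_nhds_zero_nat,
      Eventually.of_forall fun n => mem_Ioi.mpr Nat.one_div_pos_of_nat⟩
  have hmeas : ∀ ε : ℝ, MeasurableSet {s : ℝ | ε ≤ |s|} := fun ε =>
    measurableSet_le measurable_const measurable_norm
  have hcover : AECover volume atTop fun n : ℕ => {s : ℝ | (1 : ℝ) / (n + 1) ≤ |s|} := by
    refine ⟨?_, fun n => hmeas _⟩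
    filter_upwards [Measure.ae_ne volume (0 : ℝ)] with s hs
    exact tendsto_one_div_add_atTop_nhds_zero_nat.eventually_le_const (abs_pos.mpr hs)
  have hint : ∀ n : ℕ, IntegrableOn (fun s => f s / (0 - s))
      {s : ℝ | (1 : ℝ) / (n + 1) ≤ |s|} := fun n => by
    simp only [div_eq_mul_inv (f _)]
    refine hf.integrableOn.mul_bdd (c := ((1 : ℝ) / (n + 1))⁻¹) (by fun_prop) ?_
    filter_upwards [ae_restrict_mem (hmeas _)] with s hs
    rw [norm_inv, zero_sub, norm_neg]
    exact inv_anti₀ Nat.one_div_pos_of_nat hs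
  have hlim := hL.comp hu
  have hI := hcover.integrable_of_integral_tendsto_of_nonneg_ae L hint (ae_of_all _ hnn) hlim
  exact ⟨hI, tendsto_nhds_unique (hcover.integral_tendsto_of_countably_generated hI) hlim⟩

lemma tendsto_integral_mul_div_sq_add_sq {f : ℝ → ℝ} (hf : AEStronglyMeasurable f volume)
    (hint : Integrable fun s => f s / (0 - s)) :
    Tendsto (fun x : ℝ => ∫ ω : ℝ, f ω * (ω / (x ^ 2 + ω ^ 2))) (𝓝[>] 0)
      (𝓝 (-∫ s, f s / (0 - s))) := by
  rw [← integral_neg]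
  refine tendsto_integral_filter_of_dominated_convergence (fun s => ‖f s / (0 - s)‖)
    (Eventually.of_forall fun x => hf.mul (Measurable.aestronglyMeasurable (by fun_prop)))
    (Eventually.of_forall fun x => ?_) hint.norm ?_
  · filter_upwards [Measure.ae_ne volume (0 : ℝ)] with ω hω
    rw [div_eq_mul_inv (f ω), norm_mul, norm_mul]
    gcongr
    rw [norm_inv, zero_sub, norm_neg, norm_div, Real.norm_of_nonneg (by positivity : 0 ≤ x ^ 2 + ω ^ 2),
      div_le_iff₀ (by positivity), Real.norm_eq_abs, inv_mul_eq_div, le_div_iff₀ (abs_pos.mpr hω),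
      abs_mul_abs_self]
    nlinarith [sq_nonneg x]
  · filter_upwards [Measure.ae_ne volume (0 : ℝ)] with ω hω
    have hc : ContinuousAt (fun x : ℝ => f ω * (ω / (x ^ 2 + ω ^ 2))) 0 := by
      have : (0 : ℝ) ^ 2 + ω ^ 2 ≠ 0 := by positivity
      fun_prop (disch := assumption)
    convert hc.tendsto.mono_left nhdsWithin_le_nhds using 2
    field_simp
    simp [pow_two, mul_assoc]

/-- For `g` an even, unimodal (strictly decreasing somewhere) C¹ probability density
with `g'` integrable and `D(z) = ∫ g(ω)/(z-iω) dω` (Re z > 0),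
`lim_{z→0+} D'(z) = -π H[g'](0) < 0`. -/
theorem stmt5 (g : ℝ → ℝ) (heven : ∀ x, g (-x) = g x) (hg : ContDiff ℝ 1 g)
    (hnn : ∀ x, 0 ≤ g x) (hg_int : Integrable g) (hprob : ∫ ω, g ω = 1)
    (hg'_int : Integrable (deriv g))
    (huni : ∀ x > (0:ℝ), deriv g x ≤ 0)
    (hstrict : ∃ x > (0:ℝ), deriv g x < 0)
    (Hg' : ℝ)
    (hH : Tendsto (fun ε : ℝ => ∫ s in {s : ℝ | ε ≤ |s|}, deriv g s / (0 - s))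
      (𝓝[>] 0) (𝓝 (Real.pi * Hg'))) :
    Tendsto
      (fun x : ℝ =>
        deriv (fun z : ℂ => ∫ ω : ℝ, (g ω : ℂ) / (z - Complex.I * (ω : ℂ))) (x : ℂ))
      (𝓝[>] 0) (𝓝 ((-(Real.pi * Hg') : ℝ) : ℂ))
    ∧ -(Real.pi * Hg') < 0 := by
  have hodd : ∀ x, deriv g (-x) = -deriv g x := fun x => by
    have h := deriv_comp_neg (f := g) (x := x)
    rw [funext heven] at h
    rw [h, neg_neg]
  have hnonneg : ∀ s, 0 ≤ deriv g s / (0 - s) := fun s => by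
    rcases lt_trichotomy s 0 with hs | rfl | hs
    · have h := huni (-s) (by linarith)
      rw [hodd] at h
      exact div_nonneg (by linarith) (by linarith)
    · simp
    · exact div_nonneg_of_nonpos (huni s hs) (by linarith)
  obtain ⟨hint, hval⟩ := integrable_div_of_tendsto hg'_int hnonneg hH
  constructor
  · have h := tendsto_integral_mul_div_sq_add_sq hg'_int.aestronglyMeasurable hint
    rw [hval] at h
    refine ((Complex.continuous_ofReal.tendsto _).comp h).congr' ?_
    filter_upwards [self_mem_nhdsWithin] with x hx
    have hz : 0 < (x : ℂ).re := by simpa using hx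
    rw [(hasDerivAt_integral_div_sub_I_mul hg_int hz).deriv,
      integral_mul_neg_inv_sq_eq (hg.differentiable one_ne_zero) hg_int hg'_int hz,
      integral_odd_mul_inv_sub_I_mul hodd hg'_int hx]
    rfl
  · rw [← hval, neg_lt_zero, integral_pos_iff_support_of_nonneg hnonneg hint]
    obtain ⟨x₀, hx₀, hlt⟩ := hstrict
    have hopen : IsOpen ({x | deriv g x < 0} ∩ Ioi 0) :=
      (isOpen_lt (hg.continuous_deriv le_rfl) continuous_const).inter isOpen_Ioi
    refine (hopen.measure_pos volume ⟨x₀, hlt, hx₀⟩).trans_le (measure_mono ?_)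
    rintro x ⟨hx, hx0⟩
    exact div_ne_zero (ne_of_lt hx) (by simpa using (ne_of_gt hx0))
end
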